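/- arXiv:1508.02266 — 2 statements merged into one kernel-verified Lean document; each statement's English description precedes it below -/
import Mathlib

section
/- Let {v_i}_{i∈I} be the set of minimal scalings of a scalable unit-norm frame F = {f_i}_{i=1}^k in ℝ^n, and let c = Σ_{j∈J} α_j v_j be a scaling (J ⊆ I, α_j > 0, Σ α_j = 1), with orthogonal decomposition c = Σ_{i∈J₁} α_i v_i + … + Σ_{i∈J_a} α_i v_i where the sets ∪_{i∈J_m} supp(v_i), m = 1,…,a, are pairwise disjoint elements of EC(cF). If the elements of EC(cF) are pairwise disjoint, then {v_j}_{j∈J₁} ∪̇ … ∪̇ {v_j}_{j∈J_a} is the smallest orthogonal partition of {v_i}_{i∈J₁∪̇…∪̇J_a}, and hence this orthogonal decomposition of c is unique. -/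
open Finset

/-- `c` is a scaling of the unit-norm frame `f`:
`c` is entrywise nonnegative and `∑ c i • f_i f_iᵗ = I`. -/
def IsScaling {n k : ℕ} (f : Fin k → Fin n → ℝ) (c : Fin k → ℝ) : Prop :=
  (∀ i, 0 ≤ c i) ∧
    ∑ i, c i • Matrix.vecMulVec (f i) (f i) = (1 : Matrix (Fin n) (Fin n) ℝ)

/-- The support of a vector `c ∈ ℝᵏ`. -/
noncomputable def suppF {k : ℕ} (c : Fin k → ℝ) : Finset (Fin k) :=
  Finset.univ.filter (fun i => c i ≠ 0)

/-- `c` is a minimal scaling of `f`: it is a scaling and `{f_i : c i > 0}` has no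
proper scalable subframe. -/
def IsMinimalScaling {n k : ℕ} (f : Fin k → Fin n → ℝ) (c : Fin k → ℝ) : Prop :=
  IsScaling f c ∧
    ∀ S : Finset (Fin k), S ⊂ suppF c →
      ¬ ∃ d : Fin k → ℝ, (∀ i, 0 ≤ d i) ∧ (∀ i, i ∉ S → d i = 0) ∧
        ∑ i, d i • Matrix.vecMulVec (f i) (f i) = (1 : Matrix (Fin n) (Fin n) ℝ)

/-- `f` is a unit-norm frame for `ℝⁿ`: a finite spanning family of unit vectors. -/
def IsUnitNormFrame {n k : ℕ} (f : Fin k → Fin n → ℝ) : Prop :=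
  (∀ i, ∑ l, f i l ^ 2 = 1) ∧ Submodule.span ℝ (Set.range f) = ⊤
/-- The factor poset of a finite family `g` of vectors in `ℝⁿ`: all index sets `J`
such that `{g j}_{j ∈ J}` is a tight frame for `ℝⁿ`, together with `∅`. -/
def FactorPoset {n k : ℕ} (g : Fin k → Fin n → ℝ) : Set (Finset (Fin k)) :=
  {J | ∃ A : ℝ, 0 < A ∧ ∀ x : Fin n → ℝ,
      ∑ j ∈ J, (∑ l, x l * g j l) ^ 2 = A * ∑ l, x l ^ 2} ∪ {∅}

/-- The empty cover of `g`: the minimal nonempty elements of the factor poset. -/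
def EmptyCover {n k : ℕ} (g : Fin k → Fin n → ℝ) : Set (Finset (Fin k)) :=
  {J | J ∈ FactorPoset g ∧ J ≠ ∅ ∧
    ¬ ∃ J' : Finset (Fin k), J' ∈ FactorPoset g ∧ J' ≠ ∅ ∧ J' ⊂ J}

/-- The scaled frame `cF = {√c(i) f_i}`. -/
noncomputable def scaledVec {n k : ℕ} (f : Fin k → Fin n → ℝ) (c : Fin k → ℝ) :
    Fin k → Fin n → ℝ := fun i => Real.sqrt (c i) • f i

/-- `P` is an orthogonal partition of `{v j : j ∈ J}`: the blocks of `P` are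
nonempty, pairwise disjoint, cover `J`, and vectors indexed by distinct blocks
are orthogonal. -/
def IsOrthPartition {k m : ℕ} (v : Fin m → Fin k → ℝ) (J : Finset (Fin m))
    (P : Finset (Finset (Fin m))) : Prop :=
  (∀ B ∈ P, B.Nonempty) ∧ P.biUnion id = J ∧
    (∀ B₁ ∈ P, ∀ B₂ ∈ P, B₁ ≠ B₂ → Disjoint B₁ B₂) ∧
    (∀ B₁ ∈ P, ∀ B₂ ∈ P, B₁ ≠ B₂ →
      ∀ i ∈ B₁, ∀ j ∈ B₂, ∑ l, v i l * v j l = 0)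

/-- `P` is a smallest orthogonal partition of `{v j : j ∈ J}`: an orthogonal
partition no block of which can be split further into two nonempty mutually
orthogonal subsets. -/
def IsSmallestOrthPartition {k m : ℕ} (v : Fin m → Fin k → ℝ) (J : Finset (Fin m))
    (P : Finset (Finset (Fin m))) : Prop :=
  IsOrthPartition v J P ∧
    ∀ B ∈ P, ¬ ∃ B₁ B₂ : Finset (Fin m), B₁.Nonempty ∧ B₂.Nonempty ∧
      Disjoint B₁ B₂ ∧ B₁ ∪ B₂ = B ∧
      (∀ i ∈ B₁, ∀ j ∈ B₂, ∑ l, v i l * v j l = 0)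

theorem IsScaling.sum_mul_sq {n k : ℕ} {f : Fin k → Fin n → ℝ} {d : Fin k → ℝ}
    (hd : IsScaling f d) (x : Fin n → ℝ) :
    ∑ i, d i * (∑ l, x l * f i l) ^ 2 = ∑ l, x l ^ 2 := by
  have h := congrArg (fun M : Matrix (Fin n) (Fin n) ℝ => x ⬝ᵥ M.mulVec x) hd.2
  simp only [Matrix.sum_mulVec, dotProduct_sum, Matrix.smul_mulVec, Matrix.vecMulVec_mulVec,
    dotProduct_smul, Matrix.one_mulVec] at h
  simp only [dotProduct, smul_eq_mul, MulOpposite.smul_eq_mul_unop, MulOpposite.unop_op] at h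
  simp only [sq]
  rw [← h]
  refine Finset.sum_congr rfl fun i _ => ?_
  simp only [mul_comm (f i _)]

theorem mem_suppF {k : ℕ} {c : Fin k → ℝ} {l : Fin k} : l ∈ suppF c ↔ c l ≠ 0 := by
  simp [suppF]

/-- Orthogonal vectors with nonnegative entries have disjoint supports. -/
theorem mul_eq_zero_of_orthogonal_of_nonneg {k : ℕ} {x y : Fin k → ℝ} (hx : ∀ l, 0 ≤ x l)
    (hy : ∀ l, 0 ≤ y l) (h : ∑ l, x l * y l = 0) (l : Fin k) : x l * y l = 0 :=
  (Finset.sum_eq_zero_iff_of_nonneg fun l _ => mul_nonneg (hx l) (hy l)).1 h l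
    (Finset.mem_univ l)

/-- If a scaling `c` is a positive combination of scalings indexed by `J`, and `B ⊆ J` has
supports disjoint from those of `J \ B`, then the union of the supports over `B` indexes a
tight subframe of the scaled frame. -/
theorem biUnion_suppF_mem_factorPoset {n k m : ℕ} {f : Fin k → Fin n → ℝ}
    {v : Fin m → Fin k → ℝ} {c : Fin k → ℝ} (hv : ∀ i, IsScaling f (v i))
    (hc : ∀ l, 0 ≤ c l) {J B : Finset (Fin m)} {α : Fin m → ℝ} (hα : ∀ j ∈ J, 0 < α j)
    (hcv : c = ∑ j ∈ J, α j • v j) (hBJ : B ⊆ J) (hB : B.Nonempty)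
    (hdis : ∀ i ∈ B, ∀ j ∈ J, j ∉ B → ∀ l, v i l * v j l = 0) :
    B.biUnion (fun i => suppF (v i)) ∈ FactorPoset (scaledVec f c) := by
  refine Or.inl ⟨∑ i ∈ B, α i, Finset.sum_pos (fun i hi => hα i (hBJ hi)) hB, fun x => ?_⟩
  have hcl : ∀ l ∈ B.biUnion (fun i => suppF (v i)), c l = ∑ i ∈ B, α i * v i l := by
    intro l hl
    obtain ⟨i, hi, hil⟩ := Finset.mem_biUnion.1 hl
    rw [hcv, Finset.sum_apply]
    refine (Finset.sum_subset hBJ fun j hj hjB => ?_).symm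
    have := (mul_eq_zero.1 (hdis i hi j hj hjB l)).resolve_left (mem_suppF.1 hil)
    simp [this]
  calc ∑ l ∈ B.biUnion (fun i => suppF (v i)), (∑ t, x t * scaledVec f c l t) ^ 2
      = ∑ l ∈ B.biUnion (fun i => suppF (v i)),
          (∑ i ∈ B, α i * v i l) * (∑ t, x t * f l t) ^ 2 := by
        refine Finset.sum_congr rfl fun l hl => ?_
        rw [← hcl l hl]
        simp only [scaledVec, Pi.smul_apply, smul_eq_mul, mul_left_comm (x _)]
        rw [← Finset.mul_sum, mul_pow, Real.sq_sqrt (hc l)]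
    _ = ∑ l, (∑ i ∈ B, α i * v i l) * (∑ t, x t * f l t) ^ 2 := by
        refine Finset.sum_subset (Finset.subset_univ _) fun l _ hl => ?_
        rw [Finset.sum_eq_zero, zero_mul]
        intro i hi
        have : v i l = 0 := by
          by_contra h
          exact hl (Finset.mem_biUnion.2 ⟨i, hi, mem_suppF.2 h⟩)
        simp [this]
    _ = ∑ i ∈ B, α i * ∑ l, v i l * (∑ t, x t * f l t) ^ 2 := by
        simp only [Finset.sum_mul, Finset.mul_sum]
        rw [Finset.sum_comm]
        simp only [mul_assoc]
    _ = (∑ i ∈ B, α i) * ∑ t, x t ^ 2 := by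
        simp only [(hv _).sum_mul_sq, Finset.sum_mul]

/-- A scaling of a nonempty family of unit vectors has nonempty support. -/
theorem IsScaling.suppF_nonempty {n k : ℕ} {f : Fin k → Fin n → ℝ} {d : Fin k → ℝ}
    (hd : IsScaling f d) {i : Fin k} (hi : ∑ l, f i l ^ 2 = 1) : (suppF d).Nonempty := by
  by_contra h
  have hd0 : ∀ l, d l = 0 := fun l => by
    by_contra hl
    exact h ⟨l, mem_suppF.2 hl⟩
  have := hd.sum_mul_sq (f i)
  simp [hd0, hi] at this

/-- Each block of a smallest orthogonal partition is contained in any block of an orthogonal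
partition that it meets. -/
theorem IsSmallestOrthPartition.subset_of_mem {k m : ℕ} {v : Fin m → Fin k → ℝ}
    {J : Finset (Fin m)} {P Q : Finset (Finset (Fin m))} (hP : IsSmallestOrthPartition v J P)
    (hQ : IsOrthPartition v J Q) {B C : Finset (Fin m)} (hB : B ∈ P) (hC : C ∈ Q)
    {i : Fin m} (hiB : i ∈ B) (hiC : i ∈ C) : B ⊆ C := by
  by_contra h
  refine hP.2 B hB ⟨B ∩ C, B \ C, ⟨i, Finset.mem_inter.2 ⟨hiB, hiC⟩⟩,
    Finset.sdiff_nonempty.2 h, (Finset.disjoint_sdiff_inter B C).symm,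
    by rw [Finset.union_comm, Finset.sdiff_union_inter], fun p hp q hq => ?_⟩
  obtain ⟨hqB, hqC⟩ := Finset.mem_sdiff.1 hq
  have hqJ : q ∈ Q.biUnion id := by
    rw [hQ.2.1, ← hP.1.2.1]
    exact Finset.mem_biUnion.2 ⟨B, hB, hqB⟩
  obtain ⟨D, hD, hqD⟩ := Finset.mem_biUnion.1 hqJ
  refine hQ.2.2.2 C hC D hD ?_ p (Finset.mem_inter.1 hp).2 q hqD
  rintro rfl
  exact hqC hqD

theorem IsSmallestOrthPartition.subset {k m : ℕ} {v : Fin m → Fin k → ℝ}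
    {J : Finset (Fin m)} {P Q : Finset (Finset (Fin m))} (hP : IsSmallestOrthPartition v J P)
    (hQ : IsSmallestOrthPartition v J Q) : P ⊆ Q := by
  intro B hB
  obtain ⟨i, hi⟩ := hP.1.1 B hB
  have hiQ : i ∈ Q.biUnion id := by
    rw [hQ.1.2.1, ← hP.1.2.1]
    exact Finset.mem_biUnion.2 ⟨B, hB, hi⟩
  obtain ⟨C, hC, hiC⟩ := Finset.mem_biUnion.1 hiQ
  rwa [(hP.subset_of_mem hQ.1 hB hC hi hiC).antisymm (hQ.subset_of_mem hP.1 hC hB hiC hi)]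

/-- The smallest orthogonal partition is unique. -/
theorem IsSmallestOrthPartition.eq {k m : ℕ} {v : Fin m → Fin k → ℝ}
    {J : Finset (Fin m)} {P Q : Finset (Finset (Fin m))} (hP : IsSmallestOrthPartition v J P)
    (hQ : IsSmallestOrthPartition v J Q) : P = Q :=
  (hP.subset hQ).antisymm (hQ.subset hP)

/-- Suppose a scaling `c = ∑_{j ∈ J} α j • v j` of `F` has an orthogonal
decomposition into blocks `J₁, …, J_a` whose support unions are pairwise
disjoint elements of `EC(cF)`.  If the elements of `EC(cF)` are pairwise
disjoint, then `{J₁, …, J_a}` is the smallest orthogonal partition of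
`{v i : i ∈ J}`, and hence this orthogonal decomposition is unique. -/
theorem orthogonal_decomposition_unique (n k m : ℕ)
    (f : Fin k → Fin n → ℝ) (hF : IsUnitNormFrame f)
    (v : Fin m → Fin k → ℝ) (hvinj : Function.Injective v)
    (hrange : Set.range v = {c : Fin k → ℝ | IsMinimalScaling f c})
    (c : Fin k → ℝ) (hc : IsScaling f c)
    (J : Finset (Fin m)) (α : Fin m → ℝ)
    (hαpos : ∀ j ∈ J, 0 < α j) (hα1 : ∑ j ∈ J, α j = 1)
    (hcv : c = ∑ j ∈ J, α j • v j)
    (a : ℕ) (Jb : Fin a → Finset (Fin m))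
    (hJbdis : ∀ p q, p ≠ q → Disjoint (Jb p) (Jb q))
    (hJbU : Finset.univ.biUnion Jb = J)
    (hsuppEC : ∀ p, (Jb p).biUnion (fun i => suppF (v i)) ∈ EmptyCover (scaledVec f c))
    (hsuppdis : ∀ p q, p ≠ q →
      Disjoint ((Jb p).biUnion fun i => suppF (v i))
        ((Jb q).biUnion fun i => suppF (v i)))
    (hEC : ∀ E₁ ∈ EmptyCover (scaledVec f c), ∀ E₂ ∈ EmptyCover (scaledVec f c),
      E₁ ≠ E₂ → Disjoint E₁ E₂) :
    IsSmallestOrthPartition v J (Finset.univ.image Jb) ∧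
      ∀ Q : Finset (Finset (Fin m)),
        IsSmallestOrthPartition v J Q → Q = Finset.univ.image Jb := by
  have hv : ∀ i, IsScaling f (v i) := fun i => by
    have hi : v i ∈ {c : Fin k → ℝ | IsMinimalScaling f c} := hrange ▸ Set.mem_range_self i
    exact hi.1
  have hcross : ∀ p q, p ≠ q → ∀ i ∈ Jb p, ∀ j ∈ Jb q, ∀ l, v i l * v j l = 0 := by
    intro p q hpq i hi j hj l
    by_contra h
    exact Finset.disjoint_left.1 (hsuppdis p q hpq)
      (Finset.mem_biUnion.2 ⟨i, hi, mem_suppF.2 (left_ne_zero_of_mul h)⟩)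
      (Finset.mem_biUnion.2 ⟨j, hj, mem_suppF.2 (right_ne_zero_of_mul h)⟩)
  have hsub : ∀ p, Jb p ⊆ J := fun p =>
    hJbU ▸ Finset.subset_biUnion_of_mem Jb (Finset.mem_univ p)
  have hmain : IsSmallestOrthPartition v J (Finset.univ.image Jb) := by
    refine ⟨⟨?_, ?_, ?_, ?_⟩, ?_⟩
    · simp only [Finset.forall_mem_image]
      intro p _
      obtain ⟨l, hl⟩ := Finset.nonempty_iff_ne_empty.2 (hsuppEC p).2.1
      obtain ⟨i, hi, -⟩ := Finset.mem_biUnion.1 hl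
      exact ⟨i, hi⟩
    · rw [Finset.image_biUnion]
      exact hJbU
    · simp only [Finset.forall_mem_image]
      intro p _ q _ hpq
      exact hJbdis p q (ne_of_apply_ne Jb hpq)
    · simp only [Finset.forall_mem_image]
      intro p _ q _ hpq i hi j hj
      exact Finset.sum_eq_zero fun l _ => hcross p q (ne_of_apply_ne Jb hpq) i hi j hj l
    · simp only [Finset.forall_mem_image]
      rintro p - ⟨B₁, B₂, h₁, ⟨j, hj⟩, hdis, hunion, horth⟩
      have hzero : ∀ i ∈ B₁, ∀ j ∈ B₂, ∀ l, v i l * v j l = 0 := fun i hi j hj =>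
        mul_eq_zero_of_orthogonal_of_nonneg (hv i).1 (hv j).1 (horth i hi j hj)
      have hB₁ : B₁ ⊆ Jb p := hunion ▸ Finset.subset_union_left
      have hB₂ : B₂ ⊆ Jb p := hunion ▸ Finset.subset_union_right
      obtain ⟨l₀, -⟩ := Finset.nonempty_iff_ne_empty.2 (hsuppEC p).2.1
      have hne : ∀ i, (suppF (v i)).Nonempty := fun i => (hv i).suppF_nonempty (hF.1 l₀)
      refine (hsuppEC p).2.2 ⟨B₁.biUnion fun i => suppF (v i), ?_, ?_, ?_⟩
      · refine biUnion_suppF_mem_factorPoset hv hc.1 hαpos hcv (hB₁.trans (hsub p)) h₁ ?_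
        intro i hi q hq hqB l
        rw [← hJbU] at hq
        obtain ⟨r, -, hqr⟩ := Finset.mem_biUnion.1 hq
        by_cases hpr : p = r
        · subst hpr
          rw [← hunion] at hqr
          exact hzero i hi q ((Finset.mem_union.1 hqr).resolve_left hqB) l
        · exact hcross p r hpr i (hB₁ hi) q hqr l
      · obtain ⟨i, hi⟩ := h₁
        obtain ⟨l, hl⟩ := hne i
        exact Finset.ne_empty_of_mem (Finset.mem_biUnion.2 ⟨i, hi, hl⟩)
      · obtain ⟨l, hl⟩ := hne j
        refine (Finset.ssubset_iff_of_subset (Finset.biUnion_subset_biUnion_of_subset_left _ hB₁)).2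
          ⟨l, Finset.mem_biUnion.2 ⟨j, hB₂ hj, hl⟩, fun hmem => ?_⟩
        obtain ⟨i, hi, hil⟩ := Finset.mem_biUnion.1 hmem
        exact mul_ne_zero (mem_suppF.1 hil) (mem_suppF.1 hl) (hzero i hi j hj l)
  exact ⟨hmain, fun Q hQ => hQ.eq hmain⟩
end

section
/- Let {v_i}_{i∈I} be the set of minimal scalings of a scalable unit-norm frame F = {f_i}_{i=1}^k in ℝ^n, and let c be a strict scaling of F (supp(c) = {1,…,k}). If {v_i}_{i∈I} is affinely independent and c = Σ_{i∈I} α_i v_i is a convex combination of the minimal scalings, then α_i > 0 for every i ∈ I. -/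
open Finset

/-- The coefficients of a scaling of a unit-norm family in `ℝⁿ` sum to `n`. -/
theorem IsScaling.sum_eq {n k : ℕ} {f : Fin k → Fin n → ℝ} {c : Fin k → ℝ}
    (hf : ∀ i, ∑ l, f i l ^ 2 = 1) (hc : IsScaling f c) : ∑ i, c i = n := by
  have h := congrArg Matrix.trace hc.2
  have hdot : ∀ i, f i ⬝ᵥ f i = 1 := fun i => by
    simpa only [dotProduct, sq] using hf i
  simpa [Matrix.trace_sum, Matrix.trace_smul, Matrix.trace_vecMulVec, hdot] using h

/-- If `t • d ≤ c` for scalings `c` and `d` with `t < 1`, the normalized remainder of `c` is again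
a scaling. -/
theorem IsScaling.remainder {n k : ℕ} {f : Fin k → Fin n → ℝ} {c d : Fin k → ℝ} {t : ℝ}
    (hc : IsScaling f c) (hd : IsScaling f d) (ht : t < 1) (hle : ∀ i, t * d i ≤ c i) :
    IsScaling f ((1 - t)⁻¹ • (c - t • d)) := by
  have ht' : 0 < 1 - t := sub_pos.2 ht
  refine ⟨fun i => ?_, ?_⟩
  · simpa using mul_nonneg (inv_nonneg.2 ht'.le) (sub_nonneg.2 (hle i))
  · calc
      _ = (1 - t)⁻¹ • (∑ i, c i • Matrix.vecMulVec (f i) (f i)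
          - t • ∑ i, d i • Matrix.vecMulVec (f i) (f i)) := by
        simp only [Finset.smul_sum, ← Finset.sum_sub_distrib, smul_smul, ← sub_smul,
          Pi.smul_apply, Pi.sub_apply, smul_eq_mul]
      _ = 1 := by
        rw [hc.2, hd.2]
        nth_rewrite 1 [← one_smul ℝ (1 : Matrix (Fin n) (Fin n) ℝ)]
        rw [← sub_smul, smul_smul, inv_mul_cancel₀ ht'.ne', one_smul]

/-- Every scaling of a unit-norm family is a convex combination of minimal scalings. -/
theorem IsScaling.mem_convexHull {n k : ℕ} {f : Fin k → Fin n → ℝ}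
    (hf : ∀ i, ∑ l, f i l ^ 2 = 1) {c : Fin k → ℝ} (hc : IsScaling f c) :
    c ∈ convexHull ℝ {c : Fin k → ℝ | IsMinimalScaling f c} := by
  induction hN : (suppF c).card using Nat.strong_induction_on generalizing c with
  | _ N ih =>
  subst hN
  by_cases hmin : IsMinimalScaling f c
  · exact subset_convexHull ℝ _ hmin
  obtain ⟨S, hS, d, hd0, hdS, hd1⟩ : ∃ S : Finset (Fin k), S ⊂ suppF c ∧
      ∃ d : Fin k → ℝ, (∀ i, 0 ≤ d i) ∧ (∀ i, i ∉ S → d i = 0) ∧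
        ∑ i, d i • Matrix.vecMulVec (f i) (f i) = (1 : Matrix (Fin n) (Fin n) ℝ) := by
    by_contra h
    exact hmin ⟨hc, fun S hS hd => h ⟨S, hS, hd⟩⟩
  have hd : IsScaling f d := ⟨hd0, hd1⟩
  have hdc : suppF d ⊂ suppF c := by
    refine lt_of_le_of_lt (fun i hi => ?_) hS
    by_contra hiS
    exact (Finset.mem_filter.1 hi).2 (hdS i hiS)
  obtain ⟨j, hj⟩ : ∃ j, c j < d j := by
    by_contra! h
    have hsum : ∑ i, d i = ∑ i, c i := by rw [hd.sum_eq hf, hc.sum_eq hf]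
    have heq := (Finset.sum_eq_sum_iff_of_le fun i _ => h i).1 hsum
    exact hdc.ne (congrArg suppF (funext fun i => heq i (Finset.mem_univ i)))
  have hmem : ∀ i, i ∈ univ.filter (fun i => 0 < d i) ↔ 0 < d i := fun i => by simp
  have hdj : 0 < d j := (hc.1 j).trans_lt hj
  obtain ⟨p, hp, hpmin⟩ := Finset.exists_min_image (univ.filter fun i => 0 < d i)
    (fun i => c i / d i) ⟨j, (hmem j).2 hdj⟩
  rw [hmem] at hp
  set t := c p / d p with ht
  have ht0 : 0 ≤ t := div_nonneg (hc.1 p) hp.le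
  have ht1 : t < 1 := (hpmin j ((hmem j).2 hdj)).trans_lt ((div_lt_one hdj).2 hj)
  have hle : ∀ i, t * d i ≤ c i := fun i => by
    rcases (hd0 i).eq_or_lt with h | h
    · simpa [← h] using hc.1 i
    · exact (le_div_iff₀ h).1 (hpmin i ((hmem i).2 h))
  have hlt : suppF ((1 - t)⁻¹ • (c - t • d)) ⊂ suppF c := by
    refine (Finset.ssubset_iff_of_subset fun i hi => ?_).2
      ⟨p, hdc.subset (by simpa [suppF] using hp.ne'), ?_⟩
    · by_contra hic
      have hci : c i = 0 := by simpa [suppF] using hic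
      have hdi : d i = 0 := by
        by_contra h
        exact hic (hdc.subset (by simpa [suppF] using h))
      simp [suppF, hci, hdi] at hi
    · simp [suppF, ht, div_mul_cancel₀ _ hp.ne']
  have hdecomp : c = t • d + (1 - t) • ((1 - t)⁻¹ • (c - t • d)) := by
    rw [smul_inv_smul₀ (sub_pos.2 ht1).ne']
    abel
  rw [hdecomp]
  exact convex_convexHull ℝ _ (ih _ (Finset.card_lt_card hdc) hd rfl)
    (ih _ (Finset.card_lt_card hlt) (hc.remainder hd ht1 hle) rfl)
    ht0 (sub_pos.2 ht1).le (by ring)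

/-- If the minimal scalings of a scalable unit-norm frame are affinely
independent and `c` is a strict scaling written as a convex combination of the
minimal scalings, then all coefficients of the convex combination are positive. -/
theorem strict_scaling_positive_coefficients (n k m : ℕ)
    (f : Fin k → Fin n → ℝ) (hF : IsUnitNormFrame f)
    (v : Fin m → Fin k → ℝ) (hvinj : Function.Injective v)
    (hrange : Set.range v = {c : Fin k → ℝ | IsMinimalScaling f c})
    (haffind : ∀ α : Fin m → ℝ,
      ∑ i, α i • v i = 0 → ∑ i, α i = 0 → ∀ i, α i = 0)
    (c : Fin k → ℝ) (hc : IsScaling f c) (hstrict : ∀ l, c l ≠ 0)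
    (α : Fin m → ℝ) (hα0 : ∀ i, 0 ≤ α i) (hα1 : ∑ i, α i = 1)
    (hcv : c = ∑ i, α i • v i) :
    ∀ i, 0 < α i := by
  intro j
  have hvj : IsScaling f (v j) := by
    have h : v j ∈ {c : Fin k → ℝ | IsMinimalScaling f c} := hrange ▸ Set.mem_range_self j
    exact h.1
  obtain ⟨ε, hεle, hε1, hε0⟩ : ∃ ε : ℝ, (∀ l, ε * v j l ≤ c l) ∧ ε < 1 ∧ 0 < ε := by
    have hsmall : ∀ᶠ ε : ℝ in nhds 0, (∀ l, ε * v j l ≤ c l) ∧ ε < 1 := by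
      refine (Filter.eventually_all.2 fun l => ?_).and (eventually_lt_nhds one_pos)
      have hcont : Continuous fun ε : ℝ => ε * v j l := by fun_prop
      have hpos : (0 : ℝ) * v j l < c l := by
        simpa using (hc.1 l).lt_of_ne' (hstrict l)
      exact (hcont.continuousAt.eventually_lt_const hpos).mono fun _ h => h.le
    obtain ⟨ε, ⟨h1, h2⟩, h3⟩ :=
      ((hsmall.filter_mono nhdsWithin_le_nhds).and
        (self_mem_nhdsWithin : Set.Ioi (0 : ℝ) ∈ nhdsWithin 0 (Set.Ioi 0))).exists
    exact ⟨ε, h1, h2, h3⟩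
  have hmem := (hc.remainder hvj hε1 hεle).mem_convexHull hF.1
  rw [← hrange] at hmem
  obtain ⟨β, ⟨hβ0, hβ1⟩, hβ⟩ : (1 - ε)⁻¹ • (c - ε • v j) ∈
      Fintype.linearCombination ℝ v '' stdSimplex ℝ (Fin m) := by
    refine convexHull_min ?_ ((convex_stdSimplex ℝ (Fin m)).linear_image _) hmem
    rintro _ ⟨i, rfl⟩
    exact ⟨Pi.single i 1, single_mem_stdSimplex ℝ i, by simp⟩
  rw [Fintype.linearCombination_apply] at hβ
  have hε' : 0 < 1 - ε := sub_pos.2 hε1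
  have hc' : c = ε • v j + (1 - ε) • ∑ i, β i • v i := by
    rw [hβ, smul_inv_smul₀ hε'.ne']
    abel
  have hzero := haffind (fun i => α i - (ε * (if i = j then 1 else 0) + (1 - ε) * β i))
    (by
      have h1 : ∑ i, (ε * (if i = j then 1 else 0)) • v i = ε • v j := by simp
      simp only [sub_smul, add_smul, Finset.sum_sub_distrib, Finset.sum_add_distrib, h1]
      simp only [mul_smul, ← Finset.smul_sum]
      rw [← hcv, ← hc', sub_self])
    (by simp [Finset.sum_sub_distrib, Finset.sum_add_distrib, ← Finset.mul_sum, hα1, hβ1]) j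
  simp only [if_true] at hzero
  nlinarith [mul_nonneg hε'.le (hβ0 j)]
end
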